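/- The quartic f = x₃⁴ + 2q x₃²x₄² + x₄⁴ ∈ ℂ[x₃,x₄] is a semiinvariant for the action of Γ on (x₃,x₄): f is fixed by the substitution given by the block ((I₂)ᵀ)⁻¹, and the substitution given by the block ((ωτ)ᵀ)⁻¹ multiplies f by a cube root of unity; in particular the vanishing locus of f in the plane of (x₃,x₄) is invariant under Γ. -/

import Mathlib

/-!
STATEMENT 10: The quartic f = x₃⁴ + 2q x₃²x₄² + x₄⁴ ∈ ℂ[x₃,x₄] is a semiinvariant
for the action of Γ on (x₃,x₄): f is fixed by the substitution given by the block
((I₂)ᵀ)⁻¹, and the substitution given by the block ((ωτ)ᵀ)⁻¹ multiplies f by a cube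
root of unity; in particular the vanishing locus of f in the plane of (x₃,x₄) is
invariant under Γ.
-/

noncomputable section

open Matrix MvPolynomial

/-- ω = e^{2πi/3} -/
noncomputable def ω : ℂ := Complex.exp (2 * Real.pi * Complex.I / 3)

/-- q = 2ω+1, a square root of -3 -/
noncomputable def q : ℂ := 2 * ω + 1

/-- I₂ = [[i,0],[0,-i]] -/
def I₂ : Matrix (Fin 2) (Fin 2) ℂ := !![Complex.I, 0; 0, -Complex.I]

/-- τ = -(1/2)·[[1+i, -1+i],[1+i, 1-i]] -/
def τ : Matrix (Fin 2) (Fin 2) ℂ :=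
  -(1 / 2 : ℂ) • !![1 + Complex.I, -1 + Complex.I; 1 + Complex.I, 1 - Complex.I]

/-- linear substitution of the two variables (x₃,x₄) by a matrix M -/
noncomputable def subst (M : Matrix (Fin 2) (Fin 2) ℂ) :
    MvPolynomial (Fin 2) ℂ →ₐ[ℂ] MvPolynomial (Fin 2) ℂ :=
  MvPolynomial.aeval fun j => ∑ i, MvPolynomial.C (M j i) * MvPolynomial.X i

/-- the quartic f = x₃⁴ + 2q x₃²x₄² + x₄⁴ (with x₃ = X 0, x₄ = X 1) -/
noncomputable def f : MvPolynomial (Fin 2) ℂ :=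
  X 0 ^ 4 + C (2 * q) * X 0 ^ 2 * X 1 ^ 2 + X 1 ^ 4

theorem omega_rel : ω ^ 2 + ω + 1 = 0 := by
  have h : IsPrimitiveRoot ω 3 := by
    have := Complex.isPrimitiveRoot_exp 3 (by norm_num)
    simpa [ω] using this
  have := h.geom_sum_eq_zero (by norm_num)
  simp [Finset.sum_range_succ] at this
  linear_combination this

theorem inv1 : (I₂ᵀ)⁻¹ = !![-Complex.I, 0; 0, Complex.I] := by
  apply Matrix.inv_eq_right_inv
  ext i j
  fin_cases i <;> fin_cases j <;> simp [I₂, Matrix.mul_apply, Fin.sum_univ_two]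

theorem inv2 : ((ω • τ)ᵀ)⁻¹ = !![-(1/2) * ω ^ 2 * (1 - Complex.I), (1/2) * ω ^ 2 * (1 + Complex.I);
    (1/2) * ω ^ 2 * (-1 + Complex.I), -(1/2) * ω ^ 2 * (1 + Complex.I)] := by
  have hw : ω ^ 3 = 1 := by linear_combination (ω - 1) * omega_rel
  have hI := Complex.I_sq
  apply Matrix.inv_eq_right_inv
  ext i j
  fin_cases i <;> fin_cases j <;> simp [τ, Matrix.mul_apply, Fin.sum_univ_two] <;> grind

theorem subst1 : subst ((I₂ᵀ)⁻¹) f = f := by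
  have h4 : (C Complex.I : MvPolynomial (Fin 2) ℂ) ^ 2 = -1 := by
    rw [← C_pow, Complex.I_sq]; simp
  rw [inv1]
  simp [subst, f, Fin.sum_univ_two, algebraMap_eq]
  grind

theorem subst2 : subst (((ω • τ)ᵀ)⁻¹) f = C ω * f := by
  have hI : (C Complex.I : MvPolynomial (Fin 2) ℂ) ^ 2 = -1 := by
    rw [← C_pow, Complex.I_sq]; simp
  have hw : (C ω : MvPolynomial (Fin 2) ℂ) ^ 2 + C ω + 1 = 0 := by
    rw [← C_pow, ← C_1, ← C_add, ← C_add, omega_rel, C_0]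
  have hw3 : (C ω : MvPolynomial (Fin 2) ℂ) ^ 3 = 1 := by linear_combination (C ω - 1) * hw
  have h2 : (C (1/2) : MvPolynomial (Fin 2) ℂ) * 2 = 1 := by
    have : (2 : MvPolynomial (Fin 2) ℂ) = C 2 := rfl
    rw [this, ← C_mul]; norm_num
  have h2' : (C 2 : MvPolynomial (Fin 2) ℂ) = 2 := rfl
  rw [inv2]
  simp only [subst, f, q, Fin.sum_univ_two, algebraMap_eq, map_add, map_mul, map_pow, aeval_X,
    aeval_C, Matrix.of_apply, Matrix.cons_val_zero, Matrix.cons_val_one, map_neg, map_sub, map_one,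
    Matrix.cons_val', Matrix.cons_val_fin_one, h2', map_ofNat]
  generalize (C (1/2) : MvPolynomial (Fin 2) ℂ) = t at *
  generalize (C ω : MvPolynomial (Fin 2) ℂ) = w at *
  generalize (C Complex.I : MvPolynomial (Fin 2) ℂ) = i at *
  generalize (X 0 : MvPolynomial (Fin 2) ℂ) = x at *
  generalize (X 1 : MvPolynomial (Fin 2) ℂ) = y at *
  grind

theorem eval_subst (M : Matrix (Fin 2) (Fin 2) ℂ) (v : Fin 2 → ℂ) (p : MvPolynomial (Fin 2) ℂ) :
    eval (M.mulVec v) p = eval v (subst M p) := by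
  induction p using MvPolynomial.induction_on with
  | C a => simp [subst, algebraMap_eq]
  | add p q hp hq => rw [map_add, map_add, map_add, hp, hq]
  | mul_X p n hp => 
    rw [map_mul, map_mul, map_mul, hp]
    congr 1
    rw [eval_X, subst, aeval_X]
    simp only [Matrix.mulVec, dotProduct, map_sum, map_mul, eval_C, eval_X]

theorem quartic_is_semiinvariant
    (B₁ B₂ : GL (Fin 2) ℂ)
    (hB₁ : (B₁ : Matrix (Fin 2) (Fin 2) ℂ) = (I₂ᵀ)⁻¹)
    (hB₂ : (B₂ : Matrix (Fin 2) (Fin 2) ℂ) = ((ω • τ)ᵀ)⁻¹) :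
    subst ((I₂ᵀ)⁻¹) f = f ∧
    (∃ c : ℂ, c ^ 3 = 1 ∧ subst (((ω • τ)ᵀ)⁻¹) f = C c * f) ∧
    ∀ g ∈ Subgroup.closure {B₁, B₂}, ∀ v : Fin 2 → ℂ,
      MvPolynomial.eval v f = 0 →
      MvPolynomial.eval ((g : Matrix (Fin 2) (Fin 2) ℂ).mulVec v) f = 0 := by
  have hw0 : ω ≠ 0 := Complex.exp_ne_zero _
  refine ⟨subst1, ⟨ω, by linear_combination (ω - 1) * omega_rel, subst2⟩, ?_⟩
  have key : ∀ g ∈ Subgroup.closure {B₁, B₂}, ∃ c : ℂ, c ≠ 0 ∧ ∀ v : Fin 2 → ℂ,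
      eval ((g : Matrix (Fin 2) (Fin 2) ℂ).mulVec v) f = c * eval v f := by
    intro g hg
    induction hg using Subgroup.closure_induction with
    | mem x hx =>
      rcases hx with rfl | rfl
      · exact ⟨1, one_ne_zero, fun v => by rw [eval_subst, hB₁, subst1, one_mul]⟩
      · exact ⟨ω, hw0, fun v => by rw [eval_subst, hB₂, subst2]; simp⟩
    | one => exact ⟨1, one_ne_zero, fun v => by simp⟩
    | mul x y _ _ hx hy =>
      obtain ⟨c, hc, h⟩ := hx
      obtain ⟨d, hd, k⟩ := hy
      refine ⟨c * d, mul_ne_zero hc hd, fun v => ?_⟩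
      rw [Units.val_mul, ← Matrix.mulVec_mulVec, h, k, mul_assoc]
    | inv x _ hx =>
      obtain ⟨c, hc, h⟩ := hx
      refine ⟨c⁻¹, inv_ne_zero hc, fun v => ?_⟩
      have := h ((↑(x⁻¹) : Matrix (Fin 2) (Fin 2) ℂ).mulVec v)
      rw [Matrix.mulVec_mulVec, Units.mul_inv, Matrix.one_mulVec] at this
      rw [this, inv_mul_cancel_left₀ hc]
  intro g hg v hv
  obtain ⟨c, -, h⟩ := key g hg
  rw [h, hv, mul_zero]

end
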